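/- Let d ≥ 1 be an integer, b ∈ ℝ^d, σ a d×d real matrix, and set a = σσᵀ. For every K > 0 there exists a constant C > 0, depending only on d, K, |b| and |σ|, such that: for every function u : ℝ × ℝ^d → ℝ that is four times continuously differentiable with all partial derivatives up to order 4 bounded in absolute value by K, every (t,x) ∈ ℝ × ℝ^d and every h ∈ (0,1], the averaged one-step value of the weak Euler scheme satisfies |2^{-d} ∑_{ξ ∈ {-1,1}^d} u(t+h, x + h b + √h σξ) − u(t,x) − h(∂_t u(t,x) + ∑_{i=1}^d b^i ∂_{x_i} u(t,x) + (1/2) ∑_{i,j=1}^d a^{ij} ∂_{x_i}∂_{x_j} u(t,x))| ≤ C h². -/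

import Mathlib

/-- Taylor's theorem along a segment in a normed space, with the remainder bounded through the
operator norm of the first omitted derivative. -/
theorem abs_sub_taylor_sum_le {E : Type*} [NormedAddCommGroup E] [NormedSpace ℝ E]
    {u : E → ℝ} {n : ℕ} {K : ℝ} (hu : ContDiff ℝ (n + 1) u)
    (hK : ∀ p, ‖iteratedFDeriv ℝ (n + 1) u p‖ ≤ K) (p v : E) :
    |u (p + v) - ∑ k ∈ Finset.range (n + 1),
        ((k.factorial : ℝ)⁻¹ * iteratedFDeriv ℝ k u p (fun _ => v))|
      ≤ K * ‖v‖ ^ (n + 1) / (n + 1).factorial := by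
  set L : ℝ →L[ℝ] E := ContinuousLinearMap.toSpanSingleton ℝ v with hL
  have hup : ContDiff ℝ (n + 1) (fun z => u (p + z)) := hu.comp (contDiff_const.add contDiff_id)
  set f : ℝ → ℝ := (fun z => u (p + z)) ∘ L with hf
  have hfc : ContDiff ℝ (n + 1) f := hup.comp L.contDiff
  have hder : ∀ k ≤ n + 1, ∀ r : ℝ,
      iteratedDeriv k f r = iteratedFDeriv ℝ k u (p + r • v) (fun _ => v) := by
    intro k hk r
    rw [iteratedDeriv_eq_iteratedFDeriv, hf,
      L.iteratedFDeriv_comp_right hup r (by exact_mod_cast hk), iteratedFDeriv_comp_add_left]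
    simp [hL]
  obtain ⟨y, -, hy⟩ := taylor_mean_remainder_lagrange_iteratedDeriv (f := f) (x := 1) (x₀ := 0)
    (n := n) zero_ne_one hfc.contDiffOn
  have htaylor : taylorWithinEval f n (Set.uIcc 0 1) 0 1 = ∑ k ∈ Finset.range (n + 1),
      ((k.factorial : ℝ)⁻¹ * iteratedFDeriv ℝ k u p (fun _ => v)) := by
    have hunique : UniqueDiffOn ℝ (Set.uIcc (0 : ℝ) 1) := uniqueDiffOn_Icc (by simp)
    rw [taylor_within_apply]
    refine Finset.sum_congr rfl fun k hk => ?_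
    have hk' : k ≤ n + 1 := (Finset.mem_range.1 hk).le
    rw [iteratedDerivWithin_eq_iteratedDeriv (x := 0) hunique
      (hfc.contDiffAt.of_le (by exact_mod_cast hk')) Set.left_mem_uIcc, hder k hk']
    simp
  have hf1 : f 1 = u (p + v) := by simp [hf, hL]
  rw [htaylor, hf1, hder _ le_rfl] at hy
  rw [hy, sub_zero, one_pow, mul_one, abs_div, Nat.abs_cast]
  gcongr
  calc |iteratedFDeriv ℝ (n + 1) u (p + y • v) (fun _ => v)|
      ≤ ‖iteratedFDeriv ℝ (n + 1) u (p + y • v)‖ * ∏ _i : Fin (n + 1), ‖v‖ :=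
        (iteratedFDeriv ℝ (n + 1) u (p + y • v)).le_opNorm fun _ => v
    _ ≤ K * ‖v‖ ^ (n + 1) := by
        rw [Finset.prod_const, Finset.card_univ, Fintype.card_fin]
        gcongr
        exact hK _

/-- The symmetric second difference agrees with the second derivative up to fourth order. -/
theorem abs_symmetric_second_difference_sub_le {E : Type*} [NormedAddCommGroup E]
    [NormedSpace ℝ E] {u : E → ℝ} {K : ℝ} (hu : ContDiff ℝ 4 u)
    (hK : ∀ p, ‖iteratedFDeriv ℝ 4 u p‖ ≤ K) (p v : E) :
    |u (p + v) + u (p + -v) - 2 * u p - iteratedFDeriv ℝ 2 u p (fun _ => v)|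
      ≤ K * ‖v‖ ^ 4 / 12 := by
  have hneg : ∀ k : ℕ, iteratedFDeriv ℝ k u p (fun _ => -v)
      = (-1) ^ k * iteratedFDeriv ℝ k u p (fun _ => v) := fun k => by
    simpa using (iteratedFDeriv ℝ k u p).map_smul_univ (fun _ => (-1 : ℝ)) (fun _ => v)
  have hu' : ContDiff ℝ ((3 : ℕ) + 1) u := by convert hu using 1; norm_num
  have h1 := abs_sub_taylor_sum_le hu' hK p v
  have h2 := abs_sub_taylor_sum_le hu' hK p (-v)
  simp only [Finset.sum_range_succ, Finset.sum_range_zero, hneg, norm_neg] at h1 h2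
  norm_num [Nat.factorial, iteratedFDeriv_zero_apply] at h1 h2
  rw [abs_le] at *
  constructor <;> linarith [h1.1, h1.2, h2.1, h2.2]

/-- One symmetric step `±√h • z` after the drift step `h • w` reproduces the generator up to
`O(h²)`. -/
theorem abs_symmetric_euler_step_sub_le {E : Type*} [NormedAddCommGroup E] [NormedSpace ℝ E]
    {u : E → ℝ} {K : ℝ} (hu : ContDiff ℝ 4 u)
    (hK : ∀ n : ℕ, n ≤ 4 → ∀ p, ‖iteratedFDeriv ℝ n u p‖ ≤ K) (p w z : E) {h : ℝ} (hh : 0 < h) :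
    |(u (p + h • w + √h • z) + u (p + h • w + -(√h • z))) / 2 - u p
        - h * (fderiv ℝ u p w + 1 / 2 * fderiv ℝ (fderiv ℝ u) p z z)|
      ≤ K * (‖z‖ ^ 4 / 24 + ‖w‖ ^ 2 / 2 + ‖w‖ * ‖z‖ ^ 2 / 2) * h ^ 2 := by
  have hs : √h ^ 2 = h := Real.sq_sqrt hh.le
  have h1 := abs_symmetric_second_difference_sub_le hu (hK 4 le_rfl) (p + h • w) (√h • z)
  have h2 := abs_sub_taylor_sum_le (n := 1) (hu.of_le (by norm_num)) (hK 2 (by norm_num))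
    p (h • w)
  have h3 : |iteratedFDeriv ℝ 2 u (p + h • w) (fun _ => z) - iteratedFDeriv ℝ 2 u p (fun _ => z)|
      ≤ K * (h * ‖w‖) * ‖z‖ ^ 2 := by
    have hlip : ‖iteratedFDeriv ℝ 2 u (p + h • w) - iteratedFDeriv ℝ 2 u p‖ ≤ K * (h * ‖w‖) := by
      have := Convex.norm_image_sub_le_of_norm_fderiv_le (𝕜 := ℝ) (f := iteratedFDeriv ℝ 2 u)
        (C := K) (s := Set.univ) (x := p) (y := p + h • w)
        (fun x _ => hu.differentiable_iteratedFDeriv (m := 2)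
          (by exact_mod_cast (by norm_num : 2 < 4)) x)
        (fun x _ => by rw [norm_fderiv_iteratedFDeriv]; exact hK 3 (by norm_num) x)
        convex_univ trivial trivial
      simpa [norm_smul, abs_of_pos hh] using this
    calc _ = ‖(iteratedFDeriv ℝ 2 u (p + h • w) - iteratedFDeriv ℝ 2 u p) (fun _ => z)‖ := by simp
      _ ≤ ‖iteratedFDeriv ℝ 2 u (p + h • w) - iteratedFDeriv ℝ 2 u p‖ * ∏ _i : Fin 2, ‖z‖ :=
        ContinuousMultilinearMap.le_opNorm _ _
      _ ≤ _ := by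
        rw [Finset.prod_const, Finset.card_univ, Fintype.card_fin]
        gcongr
  have hsmul : iteratedFDeriv ℝ 2 u (p + h • w) (fun _ => √h • z)
      = h * iteratedFDeriv ℝ 2 u (p + h • w) (fun _ => z) := by
    rw [← hs]
    simpa [Real.sq_sqrt hh.le] using
      (iteratedFDeriv ℝ 2 u (p + h • w)).map_smul_univ (fun _ => √h) (fun _ => z)
  have h4 : ‖√h • z‖ ^ 4 = h ^ 2 * ‖z‖ ^ 4 := by
    rw [norm_smul, mul_pow, Real.norm_of_nonneg (Real.sqrt_nonneg h), ← hs]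
    simp only [Real.sqrt_sq (Real.sqrt_nonneg h)]
    ring
  rw [hsmul, h4] at h1
  simp only [Finset.sum_range_succ, Finset.sum_range_zero, iteratedFDeriv_zero_apply,
    iteratedFDeriv_one_apply, norm_smul, Real.norm_of_nonneg hh.le] at h2
  norm_num at h2
  have h5 := mul_le_mul_of_nonneg_left h3 hh.le
  rw [← abs_of_pos hh, ← abs_mul, abs_of_pos hh] at h5
  have hp : fderiv ℝ (fderiv ℝ u) p z z = iteratedFDeriv ℝ 2 u p (fun _ => z) := by
    rw [iteratedFDeriv_two_apply]
  rw [hp]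
  rw [abs_le] at *
  constructor <;> nlinarith [h1.1, h1.2, h2.1, h2.2, h5.1, h5.2]

/-- Rademacher signs are orthonormal. -/
theorem sum_rademacher_mul {d : ℕ} (k l : Fin d) :
    ∑ ξ : Fin d → Bool, (if ξ k then (1 : ℝ) else -1) * (if ξ l then (1 : ℝ) else -1)
      = if k = l then 2 ^ d else 0 := by
  split_ifs with hkl
  · subst hkl
    have : ∀ ξ : Fin d → Bool,
        (if ξ k then (1 : ℝ) else -1) * (if ξ k then (1 : ℝ) else -1) = 1 := fun ξ => by
      split_ifs <;> norm_num
    simp [this]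
  · refine Finset.sum_involution (fun ξ _ => Function.update ξ k (!ξ k)) ?_ ?_ ?_ ?_
    · intro ξ _
      rw [Function.update_self, Function.update_of_ne (Ne.symm hkl)]
      cases ξ k <;> cases ξ l <;> norm_num
    · intro ξ _ _ heq
      simpa using congrFun heq k
    · simp
    · simp

theorem sum_rademacher_bilinear {d : ℕ} {E : Type*} [NormedAddCommGroup E] [NormedSpace ℝ E]
    (B : E →L[ℝ] E →L[ℝ] ℝ) (e : Fin d → E) :
    ∑ ξ : Fin d → Bool, B (∑ k, (if ξ k then (1 : ℝ) else -1) • e k)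
        (∑ k, (if ξ k then (1 : ℝ) else -1) • e k)
      = 2 ^ d * ∑ k, B (e k) (e k) := by
  have : ∀ ξ : Fin d → Bool, B (∑ k, (if ξ k then (1 : ℝ) else -1) • e k)
        (∑ k, (if ξ k then (1 : ℝ) else -1) • e k)
      = ∑ k, ∑ l, ((if ξ k then (1 : ℝ) else -1) * (if ξ l then (1 : ℝ) else -1))
          * B (e k) (e l) := fun ξ => by
    simp only [map_sum, map_smul, _root_.sum_apply, _root_.smul_apply,
      smul_eq_mul, Finset.mul_sum, mul_assoc]
    rw [Finset.sum_comm]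
    refine Finset.sum_congr rfl fun k _ => Finset.sum_congr rfl fun l _ => by ring
  simp only [this]
  rw [Finset.sum_comm, Finset.mul_sum]
  refine Finset.sum_congr rfl fun k _ => ?_
  rw [Finset.sum_comm]
  simp only [← Finset.sum_mul, sum_rademacher_mul]
  simp

/-- Averaging over Rademacher signs `ε` turns the symmetric step into the sum over columns. -/
theorem abs_rademacher_average_sub_le {d : ℕ} {E : Type*} [NormedAddCommGroup E]
    [NormedSpace ℝ E] {u : E → ℝ} {K : ℝ} (hu : ContDiff ℝ 4 u) (hK0 : 0 ≤ K)
    (hK : ∀ n : ℕ, n ≤ 4 → ∀ p, ‖iteratedFDeriv ℝ n u p‖ ≤ K) (p w : E) (e : Fin d → E)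
    {h : ℝ} (hh : 0 < h) :
    |((2 : ℝ) ^ d)⁻¹ * (∑ ξ : Fin d → Bool,
          u (p + h • w + √h • ∑ k, (if ξ k then (1 : ℝ) else -1) • e k)) - u p
        - h * (fderiv ℝ u p w + 1 / 2 * ∑ k, fderiv ℝ (fderiv ℝ u) p (e k) (e k))|
      ≤ K * ((∑ k, ‖e k‖) ^ 4 / 24 + ‖w‖ ^ 2 / 2 + ‖w‖ * (∑ k, ‖e k‖) ^ 2 / 2) * h ^ 2 := by
  set Z : (Fin d → Bool) → E := fun ξ => ∑ k, (if ξ k then (1 : ℝ) else -1) • e k with hZ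
  have hflip : ∑ ξ, u (p + h • w + √h • Z ξ) = ∑ ξ, u (p + h • w + -(√h • Z ξ)) := by
    refine Fintype.sum_equiv (Equiv.piCongrRight fun _ => Equiv.boolNot) _ _ fun ξ => ?_
    have : Z ((Equiv.piCongrRight fun _ => Equiv.boolNot) ξ) = -Z ξ := by
      simp only [hZ, ← Finset.sum_neg_distrib]
      refine Finset.sum_congr rfl fun k _ => ?_
      cases hk : ξ k <;> simp [Pi.map, hk]
    rw [this, smul_neg, neg_neg]
  have hZnorm : ∀ ξ, ‖Z ξ‖ ≤ ∑ k, ‖e k‖ := fun ξ => by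
    refine norm_sum_le_of_le _ fun k _ => ?_
    cases ξ k <;> simp
  have hcard : ∑ _ξ : Fin d → Bool, (1 : ℝ) = 2 ^ d := by simp
  have hpow : (0 : ℝ) < 2 ^ d := by positivity
  have key : ((2 : ℝ) ^ d)⁻¹ * (∑ ξ : Fin d → Bool, u (p + h • w + √h • Z ξ)) - u p
        - h * (fderiv ℝ u p w + 1 / 2 * ∑ k, fderiv ℝ (fderiv ℝ u) p (e k) (e k))
      = ((2 : ℝ) ^ d)⁻¹ * ∑ ξ : Fin d → Bool,
        ((u (p + h • w + √h • Z ξ) + u (p + h • w + -(√h • Z ξ))) / 2 - u p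
          - h * (fderiv ℝ u p w + 1 / 2 * fderiv ℝ (fderiv ℝ u) p (Z ξ) (Z ξ))) := by
    simp only [Finset.sum_sub_distrib, ← Finset.mul_sum, Finset.sum_add_distrib,
      ← Finset.sum_div, ← hflip]
    rw [sum_rademacher_bilinear]
    simp only [Finset.sum_const, Finset.card_univ, Fintype.card_pi, Fintype.card_bool,
      Finset.prod_const, Fintype.card_fin, nsmul_eq_mul]
    push_cast
    field_simp
    ring
  rw [key, abs_mul, abs_inv, abs_of_pos hpow, inv_mul_le_iff₀ hpow, ← hcard, Finset.sum_mul]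
  refine (Finset.abs_sum_le_sum_abs _ _).trans (Finset.sum_le_sum fun ξ _ => ?_)
  refine (abs_symmetric_euler_step_sub_le hu hK p w (Z ξ) hh).trans ?_
  rw [one_mul]
  gcongr <;> exact hZnorm ξ

/-- One-step weak error of the weak Euler scheme with Rademacher increments:
the averaged one-step value approximates `u + h·L u` (with `L` the generator
plus time derivative) with error `O(h²)`. -/
theorem weak_euler_one_step_error
    (d : ℕ) (hd : 1 ≤ d) (b : Fin d → ℝ) (σ : Matrix (Fin d) (Fin d) ℝ)
    (K : ℝ) (hK : 0 < K) :
    ∃ C : ℝ, 0 < C ∧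
      ∀ (u : ℝ × (Fin d → ℝ) → ℝ),
        ContDiff ℝ 4 u →
        (∀ n : ℕ, n ≤ 4 → ∀ p, ‖iteratedFDeriv ℝ n u p‖ ≤ K) →
        ∀ (t : ℝ) (x : Fin d → ℝ) (h : ℝ), 0 < h → h ≤ 1 →
          |((2 : ℝ) ^ d)⁻¹ *
              (∑ ξ : Fin d → Bool,
                u (t + h, fun i => x i + h * b i +
                  Real.sqrt h * ∑ j, σ i j * (if ξ j then (1 : ℝ) else -1)))
            - u (t, x)
            - h * (fderiv ℝ u (t, x) (1, 0)
                + ∑ i, b i * fderiv ℝ u (t, x) (0, Pi.single i 1)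
                + (1 / 2) * ∑ i, ∑ j, (σ * σ.transpose) i j *
                    fderiv ℝ (fun p => fderiv ℝ u p (0, Pi.single j 1)) (t, x)
                      (0, Pi.single i 1))|
          ≤ C * h ^ 2 := by
  set e : Fin d → ℝ × (Fin d → ℝ) := fun k => (0, fun i => σ i k) with he
  set w : ℝ × (Fin d → ℝ) := (1, b) with hw
  have hdecomp : ∀ c : Fin d → ℝ,
      ((0, c) : ℝ × (Fin d → ℝ)) = ∑ i, c i • (0, Pi.single i 1) := fun c => by
    ext i
    · simp [Prod.fst_sum]
    · simp [Prod.snd_sum, Finset.sum_apply, Pi.single_apply]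
  refine ⟨K * ((∑ k, ‖e k‖) ^ 4 / 24 + ‖w‖ ^ 2 / 2 + ‖w‖ * (∑ k, ‖e k‖) ^ 2 / 2), ?_, ?_⟩
  · have : 0 < ‖w‖ := norm_pos_iff.2 fun h0 => one_ne_zero (congrArg Prod.fst h0)
    positivity
  intro u hu hbound t x h hh _
  convert abs_rademacher_average_sub_le hu hK.le hbound (t, x) w e hh using 2
  congr 1
  · congr 2
    refine Finset.sum_congr rfl fun ξ _ => congrArg u ?_
    have hfst : (∑ k, (if ξ k then (1 : ℝ) else -1) • e k).1 = 0 := by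
      rw [Prod.fst_sum]
      exact Finset.sum_eq_zero fun k _ => by rw [Prod.smul_fst, smul_zero]
    have hsnd : ∀ i, (∑ k, (if ξ k then (1 : ℝ) else -1) • e k).2 i
        = ∑ k, σ i k * (if ξ k then (1 : ℝ) else -1) := fun i => by
      rw [Prod.snd_sum, Finset.sum_apply]
      exact Finset.sum_congr rfl fun k _ => mul_comm _ _
    refine Prod.ext ?_ (funext fun i => ?_)
    · rw [Prod.fst_add, Prod.smul_fst, hfst]
      simp [hw]
    · rw [Prod.snd_add, Prod.smul_snd, Pi.add_apply, Pi.smul_apply, hsnd]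
      simp [hw]
  · congr 1
    have hw' : w = (1, 0) + (0, b) := by simp [hw]
    have hu1 : Differentiable ℝ (fderiv ℝ u) :=
      (hu.fderiv_right (m := 1) (by norm_num)).differentiable
        (by norm_num)
    have hsecond : ∀ v v' : ℝ × (Fin d → ℝ), fderiv ℝ (fun p => fderiv ℝ u p v) (t, x) v'
        = fderiv ℝ (fderiv ℝ u) (t, x) v' v := fun v v' => by
      rw [fderiv_clm_apply (hu1 _) (differentiableAt_const v)]
      simp
    rw [hw', map_add, hdecomp b, map_sum]
    simp only [map_smul, smul_eq_mul, hsecond, he]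
    congr 2
    have hcol : ∀ k, ((0, fun i => σ i k) : ℝ × (Fin d → ℝ))
        = ∑ i, σ i k • (0, Pi.single i 1) := fun k => hdecomp _
    simp only [hcol, map_sum, map_smul, _root_.sum_apply, _root_.smul_apply,
      smul_eq_mul, Matrix.mul_apply, Matrix.transpose_apply, Finset.sum_mul, Finset.mul_sum]
    rw [Finset.sum_comm_cycle]
    refine Finset.sum_congr rfl fun k _ => ?_
    rw [Finset.sum_comm]
    refine Finset.sum_congr rfl fun j _ => Finset.sum_congr rfl fun i _ => ?_
    ring
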